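/- For every graph G on n vertices, λ_1(G) + λ_2(G) ≤ (8/7)·n, where λ_1 and λ_2 are the largest and second largest eigenvalues of the adjacency matrix of G. -/

import Mathlib

open Matrix

/-- The adjacency matrix of a graph is Hermitian (it is real symmetric). -/
theorem adjMatrix_isHermitian {n : ℕ} (G : SimpleGraph (Fin n)) [DecidableRel G.Adj] :
    (G.adjMatrix ℝ).IsHermitian := by
  rw [Matrix.IsHermitian, conjTranspose_eq_transpose_of_trivial]
  exact G.isSymm_adjMatrix

/-- `λ₁(G) + λ₂(G)`: the sum of the two largest adjacency eigenvalues (with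
multiplicity), expressed as the supremum of `μ i + μ j` over pairs of distinct
indices `i ≠ j`, where `μ` enumerates all adjacency eigenvalues with multiplicity. -/
noncomputable def specSum {n : ℕ} (G : SimpleGraph (Fin n)) [DecidableRel G.Adj] : ℝ :=
  sSup {x : ℝ | ∃ i j : Fin n, i ≠ j ∧
    x = (adjMatrix_isHermitian G).eigenvalues i + (adjMatrix_isHermitian G).eigenvalues j}


/-! ### Bivariate integer polynomials and a subdivision positivity checker -/

namespace Cert

/-- Nonnegativity of an integer, by matching. -/
def nn : ℤ → Bool
  | .ofNat _ => true
  | .negSucc _ => false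

/-- Addition of univariate integer polynomials (coefficient lists). -/
noncomputable def radd (p : List ℤ) : List ℤ → List ℤ :=
  List.rec (motive := fun _ => List ℤ → List ℤ) (fun q => q)
    (fun a p ih q => List.rec (motive := fun _ => List ℤ) (a :: p)
      (fun b q _ => Int.add a b :: ih q) q) p

/-- Scalar multiplication. -/
noncomputable def rsmul (c : ℤ) (p : List ℤ) : List ℤ :=
  List.rec (motive := fun _ => List ℤ) [] (fun a _ ih => Int.mul c a :: ih) p

/-- Multiplication. -/
noncomputable def rmul (p q : List ℤ) : List ℤ :=
  List.rec (motive := fun _ => List ℤ) [] (fun a _ ih => radd (rsmul a q) (0 :: ih)) p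

/-- `a + (y + 1) * p`. -/
noncomputable def rsh (a : ℤ) (p : List ℤ) : List ℤ :=
  List.rec (motive := fun _ => ℤ → List ℤ) (fun a => [a])
    (fun b _ ih a => Int.add a b :: ih b) p a

/-- Taylor shift by one. -/
noncomputable def rshift (p : List ℤ) : List ℤ :=
  List.rec (motive := fun _ => List ℤ) [] (fun a _ ih => rsh a ih) p

/-- `2 ^ N * p (y / 2)`. -/
noncomputable def rhalf (N : ℕ) (p : List ℤ) : List ℤ :=
  List.rec (motive := fun _ => ℕ → List ℤ) (fun _ => [])
    (fun a _ ih N => Int.mul a (Int.ofNat (Nat.pow 2 N)) :: ih (Nat.pred N)) p N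

/-- Real evaluation. -/
noncomputable def rev : List ℤ → ℝ → ℝ
  | [], _ => 0
  | a :: p, y => a + y * rev p y

/-- Bivariate polynomials: list of rows. -/
abbrev BP := List (List ℤ)

/-- Addition. -/
noncomputable def padd (p : BP) : BP → BP :=
  List.rec (motive := fun _ => BP → BP) (fun q => q)
    (fun a p ih q => List.rec (motive := fun _ => BP) (a :: p)
      (fun b q _ => radd a b :: ih q) q) p

/-- Multiplication by a row. -/
noncomputable def prmul (r : List ℤ) (p : BP) : BP :=
  List.rec (motive := fun _ => BP) [] (fun a _ ih => rmul r a :: ih) p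

/-- Multiplication. -/
noncomputable def pmul (p q : BP) : BP :=
  List.rec (motive := fun _ => BP) [] (fun a _ ih => padd (prmul a q) ([] :: ih)) p

/-- Scalar multiplication. -/
noncomputable def psmul (c : ℤ) (p : BP) : BP :=
  List.rec (motive := fun _ => BP) [] (fun a _ ih => rsmul c a :: ih) p

/-- `a + (x + 1) * p`. -/
noncomputable def psh (a : List ℤ) (p : BP) : BP :=
  List.rec (motive := fun _ => List ℤ → BP) (fun a => [a])
    (fun b _ ih a => radd a b :: ih b) p a

/-- Taylor shift in the first variable. -/
noncomputable def pshiftx (p : BP) : BP :=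
  List.rec (motive := fun _ => BP) [] (fun a _ ih => psh a ih) p

/-- Taylor shift in the second variable. -/
noncomputable def pshifty (p : BP) : BP :=
  List.rec (motive := fun _ => BP) [] (fun a _ ih => rshift a :: ih) p

/-- Halving of the first variable. -/
noncomputable def phalfx (p : BP) : BP :=
  List.rec (motive := fun _ => BP) []
    (fun a p ih => rsmul (Int.ofNat (Nat.pow 2 p.length)) a :: ih) p

/-- Maximal row length. -/
def pwid : BP → ℕ
  | [] => 0
  | a :: p => max a.length (pwid p)

/-- Halving of the second variable, with exponent `N`. -/
noncomputable def phalfyN (N : ℕ) (p : BP) : BP :=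
  List.rec (motive := fun _ => BP) [] (fun a _ ih => rhalf N a :: ih) p

/-- Halving of the second variable. -/
noncomputable def phalfy (p : BP) : BP := phalfyN (pwid p) p

/-- Bernstein-type nonnegativity test on `[0, 1]`. -/
noncomputable def rtest (r : List ℤ) : Bool := (rshift r.reverse).all nn

/-- Bernstein-type nonnegativity test on the unit square. -/
noncomputable def test (p : BP) : Bool := (pshiftx p.reverse).all rtest

/-- Positivity test on the unit square. -/
noncomputable def stest (p : BP) : Bool := test (padd p [[Int.negSucc 0]])

/-- Real evaluation. -/
noncomputable def ev : BP → ℝ → ℝ → ℝ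
  | [], _, _ => 0
  | a :: p, x, y => rev a y + x * ev p x y

/-- The subdivision checker. -/
noncomputable def check : ℕ → Bool → BP → List BP → Bool
  | 0, _, _, _ => false
  | d + 1, true, p, qs =>
    test p || qs.any stest ||
      (check d false (phalfx p) (qs.map phalfx) &&
        check d false (pshiftx (phalfx p)) (qs.map fun q => pshiftx (phalfx q)))
  | d + 1, false, p, qs =>
    test p || qs.any stest ||
      (check d true (phalfy p) (qs.map phalfy) &&
        check d true (pshifty (phalfy p)) (qs.map fun q => pshifty (phalfy q)))

/-- Composition of a univariate polynomial with a bivariate one. -/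
noncomputable def hor (p : List ℤ) (X : BP) : BP :=
  List.rec (motive := fun _ => BP) [] (fun a _ ih => padd [[a]] (pmul X ih)) p

/-- The three pieces of the certificate. -/
inductive Pc
  | one
  | two
  | back

/-- first coordinate -/
def La : Pc → List ℤ
  | .one => [2, -1]
  | .two => [1, -1]
  | .back => [0, -1]

/-- second coordinate -/
def Lb : Pc → List ℤ
  | .one => [0, 1]
  | .two => [1, 1]
  | .back => [1, -1]

/-- weight `P` -/
def Lp : Pc → List ℤ
  | .one => [36, 0, -2, 24, -60, 29]
  | .two => [27, -27, 6]
  | .back => [12, 16]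

/-- weight `T` -/
def Lt : Pc → List ℤ
  | .one => [0, -22, 46, 64, -58]
  | .two => [30, -72, 26]
  | .back => [-8]

/-- multiplier `g` -/
def Lg : Pc → List ℤ
  | .one => [0, 131, -86, -89, 74]
  | .two => [30, 90, -38]
  | .back => [42, -45]

/-- multiplier `h` -/
def Lh : Pc → List ℤ
  | .one => [0, 0, -26, 26]
  | .two => [0, 43]
  | .back => [17, -25]

/-- multiplier `m` -/
def Lm : Pc → List ℤ
  | .one => []
  | .two => []
  | .back => [0, 14]

/-- The form `α` with weights from the second point at the first one. -/
noncomputable def alB (c d : Pc) (e : ℤ) (X Y : BP) : BP :=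
  padd (psmul 3 (pmul (hor (Lp d) Y) (pmul (hor (La c) X) (hor (La c) X))))
    (padd (pmul (padd [[288]] (psmul (-7) (hor (Lp d) Y))) (pmul (hor (Lb c) X) (hor (Lb c) X)))
      (psmul (3 * e) (pmul (hor (Lt d) Y) (pmul (hor (La c) X) (hor (Lb c) X)))))

/-- The kernel. -/
noncomputable def kB (c d : Pc) (e : ℤ) (X Y : BP) : BP :=
  padd (psmul 3 (pmul (hor (La c) X) (hor (La d) Y)))
    (psmul (7 * e) (pmul (hor (Lb c) X) (hor (Lb d) Y)))

/-- The off-diagonal coefficient, `u` is `1` or `0`. -/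
noncomputable def RB (c d : Pc) (e u : ℤ) (X Y : BP) : BP :=
  padd (psmul (144 * u) (kB c d e X Y))
    (padd (pmul (hor (Lh c) X) (hor (Lh d) Y))
      (padd (psmul (-6 * e) (padd (pmul (hor (Lb c) X) (hor (Lg d) Y))
          (pmul (hor (Lb d) Y) (hor (Lg c) X))))
        (psmul 6 (padd (pmul (hor (La c) X) (hor (Lm d) Y))
          (pmul (hor (La d) Y) (hor (Lm c) X))))))

/-- The discriminant. -/
noncomputable def FB (c d : Pc) (e u : ℤ) (X Y : BP) : BP :=
  padd (psmul 16 (pmul (alB c d e X Y) (alB d c e Y X)))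
    (psmul (-1) (pmul (RB c d e u X Y) (RB c d e u X Y)))

/-- Is the row identically zero? -/
def rzero (r : List ℤ) : Bool := r.all fun c => decide (c = 0)

/-- Divide by the square of the first variable when possible. -/
def div2 : BP → BP
  | a :: b :: p => if rzero a && rzero b then p else a :: b :: p
  | p => p

/-- Alternative polynomials. -/
noncomputable def alts (c d : Pc) (e u : ℤ) (X Y : BP) : ℕ → List BP
  | 0 => []
  | 1 => [psmul (1 - 2 * u) (kB c d e X Y)]
  | _ => [psmul (1 - 2 * u) (kB c d e X Y), psmul (-1) (RB c d e u X Y)]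

/-- Optional initial halving of the variables. -/
noncomputable def pre : Bool → Bool → BP → BP
  | false, false, p => p
  | true, false, p => phalfx p
  | false, true, p => phalfy p
  | true, true, p => phalfy (phalfx p)

/-- Checking a region. -/
noncomputable def chk (c d : Pc) (e u : ℤ) (n : ℕ) (hx hy : Bool) (X Y : BP) : Bool :=
  check 20 true (pre hx hy (div2 (FB c d e u X Y))) ((alts c d e u X Y n).map (pre hx hy))

/-! ### Soundness -/

theorem rev_radd (p q : List ℤ) (y : ℝ) : rev (radd p q) y = rev p y + rev q y := by
  induction p generalizing q with
  | nil => show rev q y = 0 + rev q y; ring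
  | cons a p ih =>
    cases q with
    | nil => show rev (a :: p) y = rev (a :: p) y + 0; ring
    | cons b q =>
      show ((a + b : ℤ) : ℝ) + y * rev (radd p q) y = (a + y * rev p y) + (b + y * rev q y)
      rw [ih]; push_cast; ring

theorem rev_rsmul (c : ℤ) (p : List ℤ) (y : ℝ) : rev (rsmul c p) y = c * rev p y := by
  induction p with
  | nil => show (0 : ℝ) = c * 0; ring
  | cons a p ih =>
    show ((c * a : ℤ) : ℝ) + y * rev (rsmul c p) y = c * (a + y * rev p y)
    rw [ih]; push_cast; ring

theorem rev_rmul (p q : List ℤ) (y : ℝ) : rev (rmul p q) y = rev p y * rev q y := by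
  induction p with
  | nil => show (0 : ℝ) = 0 * _; ring
  | cons a p ih =>
    show rev (radd (rsmul a q) (0 :: rmul p q)) y = (a + y * rev p y) * rev q y
    rw [rev_radd, rev_rsmul]
    show _ + (((0 : ℤ) : ℝ) + y * rev (rmul p q) y) = _
    rw [ih]; push_cast; ring

theorem rev_rsh (a : ℤ) (p : List ℤ) (y : ℝ) : rev (rsh a p) y = a + (y + 1) * rev p y := by
  induction p generalizing a with
  | nil => show (a : ℝ) + y * 0 = a + (y + 1) * 0; ring
  | cons b p ih =>
    show ((a + b : ℤ) : ℝ) + y * rev (rsh b p) y = a + (y + 1) * (b + y * rev p y)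
    rw [ih]; push_cast; ring

theorem rev_rshift (p : List ℤ) (y : ℝ) : rev (rshift p) y = rev p (y + 1) := by
  induction p with
  | nil => rfl
  | cons a p ih =>
    show rev (rsh a (rshift p)) y = a + (y + 1) * rev p (y + 1)
    rw [rev_rsh, ih]

theorem rev_rhalf (p : List ℤ) (N : ℕ) (h : p.length ≤ N + 1) (y : ℝ) :
    rev (rhalf N p) y = 2 ^ N * rev p (y / 2) := by
  induction p generalizing N with
  | nil => show (0 : ℝ) = _ * 0; ring
  | cons a p ih =>
    show ((a * ((2 ^ N : ℕ) : ℤ) : ℤ) : ℝ) + y * rev (rhalf (N - 1) p) y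
      = 2 ^ N * (a + y / 2 * rev p (y / 2))
    simp only [List.length_cons] at h
    rcases N with _ | N
    · have : p = [] := List.eq_nil_of_length_eq_zero (by omega)
      subst this
      show ((a * ((2 ^ 0 : ℕ) : ℤ) : ℤ) : ℝ) + y * 0 = 2 ^ 0 * (a + y / 2 * 0)
      push_cast; ring
    · rw [Nat.add_sub_cancel, ih N (by omega)]
      push_cast; ring

theorem ev_padd (p q : BP) (x y : ℝ) : ev (padd p q) x y = ev p x y + ev q x y := by
  induction p generalizing q with
  | nil => show ev q x y = 0 + ev q x y; ring
  | cons a p ih =>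
    cases q with
    | nil => show ev (a :: p) x y = ev (a :: p) x y + 0; ring
    | cons b q =>
      show rev (radd a b) y + x * ev (padd p q) x y
        = (rev a y + x * ev p x y) + (rev b y + x * ev q x y)
      rw [ih, rev_radd]; ring

theorem ev_prmul (r : List ℤ) (p : BP) (x y : ℝ) : ev (prmul r p) x y = rev r y * ev p x y := by
  induction p with
  | nil => show (0 : ℝ) = _ * 0; ring
  | cons a p ih =>
    show rev (rmul r a) y + x * ev (prmul r p) x y = _ * (rev a y + x * ev p x y)
    rw [ih, rev_rmul]; ring

theorem ev_pmul (p q : BP) (x y : ℝ) : ev (pmul p q) x y = ev p x y * ev q x y := by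
  induction p with
  | nil => show (0 : ℝ) = 0 * _; ring
  | cons a p ih =>
    show ev (padd (prmul a q) ([] :: pmul p q)) x y = (rev a y + x * ev p x y) * _
    rw [ev_padd, ev_prmul]
    show _ + (0 + x * ev (pmul p q) x y) = _
    rw [ih]; ring

theorem ev_psmul (c : ℤ) (p : BP) (x y : ℝ) : ev (psmul c p) x y = c * ev p x y := by
  induction p with
  | nil => show (0 : ℝ) = _ * 0; ring
  | cons a p ih =>
    show rev (rsmul c a) y + x * ev (psmul c p) x y = _ * (rev a y + x * ev p x y)
    rw [ih, rev_rsmul]; ring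

theorem ev_psh (a : List ℤ) (p : BP) (x y : ℝ) :
    ev (psh a p) x y = rev a y + (x + 1) * ev p x y := by
  induction p generalizing a with
  | nil => show rev a y + x * 0 = rev a y + (x + 1) * 0; ring
  | cons b p ih =>
    show rev (radd a b) y + x * ev (psh b p) x y = rev a y + (x + 1) * (rev b y + x * ev p x y)
    rw [ih, rev_radd]; ring

theorem ev_pshiftx (p : BP) (x y : ℝ) : ev (pshiftx p) x y = ev p (x + 1) y := by
  induction p with
  | nil => rfl
  | cons a p ih =>
    show ev (psh a (pshiftx p)) x y = rev a y + (x + 1) * ev p (x + 1) y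
    rw [ev_psh, ih]

theorem ev_pshifty (p : BP) (x y : ℝ) : ev (pshifty p) x y = ev p x (y + 1) := by
  induction p with
  | nil => rfl
  | cons a p ih =>
    show rev (rshift a) y + x * ev (pshifty p) x y = rev a (y + 1) + x * ev p x (y + 1)
    rw [rev_rshift, ih]

theorem ev_phalfx (p : BP) (x y : ℝ) :
    2 * ev (phalfx p) x y = 2 ^ p.length * ev p (x / 2) y := by
  induction p with
  | nil => show (2 : ℝ) * 0 = _ * 0; ring
  | cons a p ih =>
    show 2 * (rev (rsmul ((2 ^ p.length : ℕ) : ℤ) a) y + x * ev (phalfx p) x y)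
      = 2 ^ (p.length + 1) * (rev a y + x / 2 * ev p (x / 2) y)
    rw [rev_rsmul]
    push_cast
    linear_combination x * ih

theorem ev_phalfyN (p : BP) (N : ℕ) (h : pwid p ≤ N) (x y : ℝ) :
    ev (phalfyN N p) x y = 2 ^ N * ev p x (y / 2) := by
  induction p with
  | nil => show (0 : ℝ) = _ * 0; ring
  | cons a p ih =>
    have h' : max a.length (pwid p) ≤ N := h
    show rev (rhalf N a) y + x * ev (phalfyN N p) x y = 2 ^ N * (rev a (y / 2) + x * ev p x (y / 2))
    rw [rev_rhalf _ _ (by omega), ih (by omega)]; ring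

theorem ev_hor (p : List ℤ) (X : BP) (x y : ℝ) : ev (hor p X) x y = rev p (ev X x y) := by
  induction p with
  | nil => rfl
  | cons a p ih =>
    show ev (padd [[a]] (pmul X (hor p X))) x y = a + _ * rev p _
    rw [ev_padd, ev_pmul, ih]
    simp [ev, rev]

theorem nn_sound {c : ℤ} (h : nn c = true) : 0 ≤ c := by
  cases c with
  | ofNat n => exact Int.natCast_nonneg n
  | negSucc n => exact absurd h (by simp [nn])

theorem rev_nonneg (p : List ℤ) (h : p.all nn = true) {y : ℝ} (hy : 0 ≤ y) : 0 ≤ rev p y := by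
  induction p with
  | nil => exact le_refl _
  | cons a p ih =>
    simp only [List.all_cons, Bool.and_eq_true] at h
    have h1 : (0 : ℝ) ≤ a := by exact_mod_cast nn_sound h.1
    exact add_nonneg h1 (mul_nonneg hy (ih h.2))

theorem rev_append (p : List ℤ) (a : ℤ) (y : ℝ) :
    rev (p ++ [a]) y = rev p y + a * y ^ p.length := by
  induction p with
  | nil => simp [rev]
  | cons b p ih => simp only [List.cons_append, rev, ih, List.length_cons]; ring

theorem rev_reverse (p : List ℤ) (y z : ℝ) (h : y * z = 1) :
    y ^ p.length * rev p.reverse z = y * rev p y := by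
  induction p with
  | nil => simp [rev]
  | cons a p ih =>
    have h2 : y ^ p.length * z ^ p.length = 1 := by rw [← mul_pow, h, one_pow]
    simp only [List.reverse_cons, rev_append, List.length_cons, List.length_reverse, rev]
    linear_combination y * ih + a * y * h2

theorem ev_append (p : BP) (a : List ℤ) (x y : ℝ) :
    ev (p ++ [a]) x y = ev p x y + rev a y * x ^ p.length := by
  induction p with
  | nil => simp [ev]
  | cons b p ih => simp only [List.cons_append, ev, ih, List.length_cons]; ring

theorem ev_reverse (p : BP) (x z y : ℝ) (h : x * z = 1) :
    x ^ p.length * ev p.reverse z y = x * ev p x y := by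
  induction p with
  | nil => simp [ev]
  | cons a p ih =>
    have h2 : x ^ p.length * z ^ p.length = 1 := by rw [← mul_pow, h, one_pow]
    simp only [List.reverse_cons, ev_append, List.length_cons, List.length_reverse, ev]
    linear_combination x * ih + rev a y * x * h2

theorem rev_cont (p : List ℤ) : Continuous (rev p) := by
  induction p with
  | nil => exact continuous_const
  | cons a p ih => exact continuous_const.add (continuous_id.mul ih)

theorem ev_cont (p : BP) (y : ℝ) : Continuous (fun x => ev p x y) := by
  induction p with
  | nil => exact continuous_const
  | cons a p ih => exact continuous_const.add (continuous_id.mul ih)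

theorem nonneg_at_zero {f : ℝ → ℝ} (hf : Continuous f) (h : ∀ x, 0 < x → x ≤ 1 → 0 ≤ f x) :
    ∀ x, 0 ≤ x → x ≤ 1 → 0 ≤ f x := by
  intro x hx hx1
  rcases hx.lt_or_eq with hx | hx
  · exact h x hx hx1
  · subst hx
    have ht : Filter.Tendsto f (nhdsWithin 0 (Set.Ioi 0)) (nhds (f 0)) :=
      hf.continuousAt.continuousWithinAt
    refine ge_of_tendsto ht ?_
    filter_upwards [Ioc_mem_nhdsGT (zero_lt_one' ℝ)] with x hx
    exact h x hx.1 hx.2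

theorem rtest_sound (r : List ℤ) (h : rtest r = true) :
    ∀ y, 0 ≤ y → y ≤ 1 → 0 ≤ rev r y := by
  refine nonneg_at_zero (rev_cont r) fun y hy hy1 => ?_
  have h1 : 1 ≤ 1 / y := by rw [le_div_iff₀ hy]; linarith
  have h2 := rev_nonneg _ h (y := 1 / y - 1) (by linarith)
  rw [rev_rshift, sub_add_cancel] at h2
  have h3 := rev_reverse r y (1 / y) (by field_simp)
  have h4 : 0 ≤ y * rev r y := by rw [← h3]; positivity
  exact nonneg_of_mul_nonneg_right h4 hy

theorem ev_nonneg (p : BP) (h : p.all rtest = true) {x y : ℝ} (hx : 0 ≤ x) (hy : 0 ≤ y)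
    (hy1 : y ≤ 1) : 0 ≤ ev p x y := by
  induction p with
  | nil => exact le_refl _
  | cons a p ih =>
    simp only [List.all_cons, Bool.and_eq_true] at h
    exact add_nonneg (rtest_sound a h.1 y hy hy1) (mul_nonneg hx (ih h.2))

theorem test_sound (p : BP) (h : test p = true) {x y : ℝ} (hx : 0 ≤ x) (hx1 : x ≤ 1)
    (hy : 0 ≤ y) (hy1 : y ≤ 1) : 0 ≤ ev p x y := by
  revert x
  intro x hx hx1
  refine nonneg_at_zero (ev_cont p y) (fun x hx hx1 => ?_) x hx hx1
  have h1 : 1 ≤ 1 / x := by rw [le_div_iff₀ hx]; linarith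
  have h2 := ev_nonneg _ h (x := 1 / x - 1) (by linarith) hy hy1
  rw [ev_pshiftx, sub_add_cancel] at h2
  have h3 := ev_reverse p x (1 / x) y (by field_simp)
  have h4 : 0 ≤ x * ev p x y := by rw [← h3]; positivity
  exact nonneg_of_mul_nonneg_right h4 hx

theorem stest_sound (p : BP) (h : stest p = true) {x y : ℝ} (hx : 0 ≤ x) (hx1 : x ≤ 1)
    (hy : 0 ≤ y) (hy1 : y ≤ 1) : 0 < ev p x y := by
  have h1 := test_sound _ h hx hx1 hy hy1
  rw [ev_padd] at h1
  simp [ev, rev] at h1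
  linarith

theorem ev_phalfx' (p : BP) : ∃ k : ℝ, 0 < k ∧ ∀ x y, ev (phalfx p) x y = k * ev p (x / 2) y := by
  refine ⟨2 ^ p.length / 2, by positivity, fun x y => ?_⟩
  linarith [ev_phalfx p x y]

theorem ev_phalfy' (p : BP) : ∃ k : ℝ, 0 < k ∧ ∀ x y, ev (phalfy p) x y = k * ev p x (y / 2) :=
  ⟨2 ^ pwid p, by positivity, fun x y => ev_phalfyN p _ le_rfl x y⟩

/-- The conclusion of a successful check at one point. -/
def Ok (p : BP) (qs : List BP) (x y : ℝ) : Prop := 0 ≤ ev p x y ∨ ∃ q ∈ qs, 0 < ev q x y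

theorem Ok_map (p : BP) (qs : List BP) (f : BP → BP) (x y x' y' : ℝ)
    (hf : ∀ p, ∃ k : ℝ, 0 < k ∧ ev (f p) x' y' = k * ev p x y)
    (h : Ok (f p) (qs.map f) x' y') : Ok p qs x y := by
  rcases h with h | ⟨q, hq, h⟩
  · obtain ⟨k, hk, e⟩ := hf p
    rw [e] at h
    exact Or.inl (nonneg_of_mul_nonneg_right h hk)
  · obtain ⟨q0, hq0, rfl⟩ := List.mem_map.1 hq
    obtain ⟨k, hk, e⟩ := hf q0
    rw [e] at h
    exact Or.inr ⟨q0, hq0, (pos_iff_pos_of_mul_pos h).1 hk⟩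

theorem check_sound (d : ℕ) (b : Bool) (p : BP) (qs : List BP) (h : check d b p qs = true)
    {x y : ℝ} (hx : 0 ≤ x) (hx1 : x ≤ 1) (hy : 0 ≤ y) (hy1 : y ≤ 1) : Ok p qs x y := by
  induction d generalizing b p qs x y with
  | zero => simp [check] at h
  | succ d ih =>
    have key : ∀ p qs, (test p || qs.any stest) = true → Ok p qs x y := by
      intro p qs h
      rw [Bool.or_eq_true, List.any_eq_true] at h
      rcases h with h | ⟨q, hq, h⟩
      · exact Or.inl (test_sound p h hx hx1 hy hy1)
      · exact Or.inr ⟨q, hq, stest_sound q h hx hx1 hy hy1⟩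
    cases b with
    | true =>
      rw [check, Bool.or_eq_true, Bool.and_eq_true] at h
      rcases h with h | ⟨h1, h2⟩
      · exact key p qs h
      · rcases le_total x (1 / 2) with hc | hc
        · refine Ok_map p qs phalfx x y (2 * x) y (fun p => ?_)
            (ih false _ _ h1 (by linarith) (by linarith) hy hy1)
          obtain ⟨k, hk, e⟩ := ev_phalfx' p
          exact ⟨k, hk, by rw [e]; congr 2; ring⟩
        · refine Ok_map p qs (fun q => pshiftx (phalfx q)) x y (2 * x - 1) y (fun p => ?_)
            (ih false _ _ h2 (by linarith) (by linarith) hy hy1)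
          obtain ⟨k, hk, e⟩ := ev_phalfx' p
          exact ⟨k, hk, by rw [ev_pshiftx, e]; congr 2; ring⟩
    | false =>
      rw [check, Bool.or_eq_true, Bool.and_eq_true] at h
      rcases h with h | ⟨h1, h2⟩
      · exact key p qs h
      · rcases le_total y (1 / 2) with hc | hc
        · refine Ok_map p qs phalfy x y x (2 * y) (fun p => ?_)
            (ih true _ _ h1 hx hx1 (by linarith) (by linarith))
          obtain ⟨k, hk, e⟩ := ev_phalfy' p
          exact ⟨k, hk, by rw [e]; congr 2; ring⟩
        · refine Ok_map p qs (fun q => pshifty (phalfy q)) x y x (2 * y - 1) (fun p => ?_)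
            (ih true _ _ h2 hx hx1 (by linarith) (by linarith))
          obtain ⟨k, hk, e⟩ := ev_phalfy' p
          exact ⟨k, hk, by rw [ev_pshifty, e]; congr 2; ring⟩

theorem rzero_sound (r : List ℤ) (h : rzero r = true) (y : ℝ) : rev r y = 0 := by
  induction r with
  | nil => rfl
  | cons a r ih =>
    simp only [rzero, List.all_cons, Bool.and_eq_true, decide_eq_true_eq] at h
    simp [rev, h.1, ih h.2]

theorem div2_sound (p : BP) (x y : ℝ) (h : 0 ≤ ev (div2 p) x y) : 0 ≤ ev p x y := by
  unfold div2 at h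
  split at h
  · split_ifs at h with hc
    · rw [Bool.and_eq_true] at hc
      simp only [ev, rzero_sound _ hc.1, rzero_sound _ hc.2]
      have := mul_nonneg (mul_self_nonneg x) h
      nlinarith
    · exact h
  · exact h

/-! ### Real versions -/

/-- real `α` -/
noncomputable def al (c d : Pc) (e x y : ℝ) : ℝ :=
  3 * rev (Lp d) y * rev (La c) x ^ 2 + (288 - 7 * rev (Lp d) y) * rev (Lb c) x ^ 2
    + 3 * e * rev (Lt d) y * (rev (La c) x * rev (Lb c) x)

/-- real kernel -/
noncomputable def ker (c d : Pc) (e x y : ℝ) : ℝ :=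
  3 * (rev (La c) x * rev (La d) y) + 7 * e * (rev (Lb c) x * rev (Lb d) y)

/-- real off-diagonal part -/
noncomputable def off (c d : Pc) (e x y : ℝ) : ℝ :=
  rev (Lh c) x * rev (Lh d) y
    - 6 * e * (rev (Lb c) x * rev (Lg d) y + rev (Lb d) y * rev (Lg c) x)
    + 6 * (rev (La c) x * rev (Lm d) y + rev (La d) y * rev (Lm c) x)

theorem ev_alB (c d : Pc) (e : ℤ) (X Y : BP) (s t : ℝ) :
    ev (alB c d e X Y) s t = al c d e (ev X s t) (ev Y s t) := by
  simp only [alB, ev_padd, ev_psmul, ev_pmul, ev_hor, al]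
  simp only [ev, rev]
  push_cast; ring

theorem ev_kB (c d : Pc) (e : ℤ) (X Y : BP) (s t : ℝ) :
    ev (kB c d e X Y) s t = ker c d e (ev X s t) (ev Y s t) := by
  simp only [kB, ev_padd, ev_psmul, ev_pmul, ev_hor, ker]
  push_cast; ring

theorem ev_RB (c d : Pc) (e u : ℤ) (X Y : BP) (s t : ℝ) :
    ev (RB c d e u X Y) s t = 144 * (u * ker c d e (ev X s t) (ev Y s t))
      + off c d e (ev X s t) (ev Y s t) := by
  simp only [RB, ev_padd, ev_psmul, ev_pmul, ev_hor, off, ev_kB]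
  push_cast; ring

/-- The result of a check. -/
def Res (c d : Pc) (e u : ℤ) (x y : ℝ) : Prop :=
  (144 * (u * ker c d e x y) + off c d e x y) ^ 2 ≤ 16 * (al c d e x y * al d c e y x) ∨
    0 < (1 - 2 * u) * ker c d e x y ∨ 144 * (u * ker c d e x y) + off c d e x y < 0

theorem Res_symm (c d : Pc) (e u : ℤ) (x y : ℝ) (h : Res c d e u x y) : Res d c e u y x := by
  have h1 : ker d c e y x = ker c d e x y := by unfold ker; ring
  have h2 : off d c e y x = off c d e x y := by unfold off; ring
  unfold Res at *
  rw [h1, h2, mul_comm (al d c e y x)]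
  exact h

theorem Res_of_Ok (c d : Pc) (e u : ℤ) (n : ℕ) (X Y : BP) (s t : ℝ)
    (h : Ok (div2 (FB c d e u X Y)) (alts c d e u X Y n) s t) :
    Res c d e u (ev X s t) (ev Y s t) := by
  rcases h with h | ⟨q, hq, h⟩
  · have h := div2_sound _ _ _ h
    simp only [FB, ev_padd, ev_psmul, ev_pmul, ev_alB, ev_RB] at h
    push_cast at h
    left; linarith
  · have hq' : q = psmul (1 - 2 * u) (kB c d e X Y) ∨ q = psmul (-1) (RB c d e u X Y) := by
      unfold alts at hq
      split at hq <;> simp at hq <;> tauto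
    rcases hq' with rfl | rfl
    · right; left
      rw [ev_psmul, ev_kB] at h
      push_cast at h; exact h
    · right; right
      rw [ev_psmul, ev_RB] at h
      push_cast at h; linarith

/-- Upper end of a parameter range. -/
noncomputable def hb : Bool → ℝ
  | true => 1 / 2
  | false => 1

theorem chk_sound {c d : Pc} {e u : ℤ} {n : ℕ} {hx hy : Bool} {X Y : BP}
    (h : chk c d e u n hx hy X Y = true) {s t : ℝ} (hs : 0 ≤ s) (hs1 : s ≤ hb hx) (ht : 0 ≤ t)
    (ht1 : t ≤ hb hy) : Res c d e u (ev X s t) (ev Y s t) := by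
  apply Res_of_Ok c d e u n
  unfold chk at h
  cases hx <;> cases hy <;> simp only [hb] at hs1 ht1
  · refine Ok_map _ _ (pre false false) s t s t (fun p => ⟨1, one_pos, (one_mul _).symm⟩)
      (check_sound _ _ _ _ h hs hs1 ht ht1)
  · refine Ok_map _ _ (pre false true) s t s (2 * t) (fun p => ?_)
      (check_sound _ _ _ _ h hs hs1 (by linarith) (by linarith))
    obtain ⟨k, hk, e⟩ := ev_phalfy' p
    exact ⟨k, hk, by rw [pre, e]; congr 2; ring⟩
  · refine Ok_map _ _ (pre true false) s t (2 * s) t (fun p => ?_)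
      (check_sound _ _ _ _ h (by linarith) (by linarith) ht ht1)
    obtain ⟨k, hk, e⟩ := ev_phalfx' p
    exact ⟨k, hk, by rw [pre, e]; congr 2; ring⟩
  · refine Ok_map _ _ (pre true true) s t (2 * s) (2 * t) (fun p => ?_)
      (check_sound _ _ _ _ h (by linarith) (by linarith) (by linarith) (by linarith))
    obtain ⟨k, hk, e⟩ := ev_phalfx' p
    obtain ⟨k', hk', e'⟩ := ev_phalfy' (phalfx p)
    refine ⟨k' * k, by positivity, ?_⟩
    rw [pre, e', e, mul_assoc]; congr 3 <;> ring


/-! ### The checks -/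

set_option maxRecDepth 100000

/-- All checks for two points of the first front piece. -/
noncomputable def chk11 (e u : ℤ) (n : ℕ) : Bool :=
  chk .one .one e u n true false [[0], [1]] [[0], [0, 1]] &&
  chk .one .one e u n true false [[0], [1]] [[1], [0, -1]] &&
  chk .one .one e u n true false [[0], [0, 1]] [[1], [-1]] &&
  chk .one .one e u n true false [[1], [-1]] [[1], [0, -1]]

/-- All checks for points of the first and the second front pieces. -/
noncomputable def chk12 (e u : ℤ) (n : ℕ) : Bool :=
  chk .one .two e u n true false [[0], [1]] [[0], [0, 2]] &&
  chk .one .two e u n false true [[0], [0, 1]] [[0], [1]] &&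
  chk .one .two e u n true false [[1], [-1]] [[0], [0, 2]] &&
  chk .one .two e u n false true [[1], [0, -1]] [[0], [1]]

/-- The check for two points of the second front piece. -/
noncomputable def chk22 (e u : ℤ) (n : ℕ) : Bool :=
  chk .two .two e u n false false [[0], [1]] [[0], [0, 1]]

/-- The check for a point and a point of the back piece. -/
noncomputable def chkb (c : Pc) (e u : ℤ) : Bool :=
  chk c .back e u 2 false false [[], [1]] [[0, 1]]

/-- The check of nonnegativity of `α`. -/
noncomputable def chka (c d : Pc) (e : ℤ) : Bool :=
  check 20 true (alB c d e [[], [1]] [[0, 1]]) []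

theorem chk11_a : chk11 1 1 0 = true := by decide +kernel
theorem chk11_b : chk11 (-1) 1 1 = true := by decide +kernel
theorem chk11_c : chk11 (-1) 0 1 = true := by decide +kernel
theorem chk12_a : chk12 1 1 0 = true := by decide +kernel
theorem chk12_b : chk12 (-1) 1 1 = true := by decide +kernel
theorem chk12_c : chk12 (-1) 0 1 = true := by decide +kernel
theorem chk22_a : chk22 1 1 0 = true := by decide +kernel
theorem chk22_b : chk22 (-1) 1 1 = true := by decide +kernel
theorem chk22_c : chk22 (-1) 0 1 = true := by decide +kernel
theorem chkb_one : (chkb .one 1 1 && chkb .one 1 0 && chkb .one (-1) 1 && chkb .one (-1) 0) = true := by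
  decide +kernel
theorem chkb_two : (chkb .two 1 1 && chkb .two 1 0 && chkb .two (-1) 1 && chkb .two (-1) 0) = true := by
  decide +kernel
theorem chkb_back :
    (chkb .back 1 1 && chkb .back 1 0 && chkb .back (-1) 1 && chkb .back (-1) 0) = true := by
  decide +kernel
theorem chka_one : ([Pc.one, .two, .back].all fun d => chka .one d 1 && chka .one d (-1)) = true := by
  decide +kernel
theorem chka_two : ([Pc.one, .two, .back].all fun d => chka .two d 1 && chka .two d (-1)) = true := by
  decide +kernel
theorem chka_back :
    ([Pc.one, .two, .back].all fun d => chka .back d 1 && chka .back d (-1)) = true := by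
  decide +kernel

/-! ### From checks to pointwise statements -/

theorem par {u v c : ℝ} (hu : 0 ≤ u) (hv : 0 ≤ v) (hc : 0 ≤ c) (h : v ≤ c * u) :
    ∃ t, 0 ≤ t ∧ t ≤ c ∧ v = u * t := by
  rcases hu.lt_or_eq with hu | hu
  · refine ⟨v / u, by positivity, ?_, by field_simp⟩
    rw [div_le_iff₀ hu]; exact h
  · subst hu
    exact ⟨0, le_rfl, hc, by linarith⟩

theorem Res_of_eq {c d : Pc} {e u : ℤ} {x y x' y' : ℝ} (h : Res c d e u x' y') (hx : x = x')
    (hy : y = y') : Res c d e u x y := by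
  rw [hx, hy]; exact h

theorem Res11 {e u : ℤ} {n : ℕ} (h : chk11 e u n = true) {x y : ℝ} (hx : 0 ≤ x) (hx1 : x ≤ 1)
    (hy : 0 ≤ y) (hy1 : y ≤ 1) : Res .one .one e u x y := by
  have main : ∀ x y : ℝ, 0 ≤ x → x ≤ 1 → 0 ≤ y → y ≤ 1 → x ≤ y → Res .one .one e u x y := by
    intro x y hx hx1 hy hy1 hxy
    simp only [chk11, Bool.and_eq_true] at h
    obtain ⟨⟨⟨h1, h2⟩, h3⟩, h4⟩ := h
    rcases le_total x (1 / 2) with hc | hc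
    · rcases le_total y (1 / 2) with hd | hd
      · obtain ⟨t, ht, ht1, rfl⟩ := par hy hx zero_le_one (by linarith)
        apply Res_symm
        refine Res_of_eq (chk_sound h1 (s := y) (t := t) hy hd ht ht1) ?_ ?_ <;> simp [ev, rev]
      · rcases le_total (1 - y) x with hz | hz
        · obtain ⟨t, ht, ht1, hq⟩ := par hx (v := 1 - y) (by linarith) zero_le_one (by linarith)
          refine Res_of_eq (chk_sound h2 (s := x) (t := t) hx hc ht ht1) ?_ ?_ <;> simp [ev, rev]
          linarith
        · obtain ⟨t, ht, ht1, hq⟩ := par (u := 1 - y) (by linarith) hx zero_le_one (by linarith)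
          refine Res_of_eq (chk_sound h3 (s := 1 - y) (t := t) (by linarith)
            (by simp only [hb]; linarith) ht ht1) ?_ ?_ <;> simp [ev, rev]
          linarith
    · obtain ⟨t, ht, ht1, hq⟩ := par (u := 1 - x) (v := 1 - y) (by linarith) (by linarith)
        zero_le_one (by linarith)
      refine Res_of_eq (chk_sound h4 (s := 1 - x) (t := t) (by linarith)
        (by simp only [hb]; linarith) ht ht1) ?_ ?_ <;> simp [ev, rev]
      linarith
  rcases le_total x y with hxy | hxy
  · exact main x y hx hx1 hy hy1 hxy
  · exact Res_symm _ _ _ _ _ _ (main y x hy hy1 hx hx1 hxy)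

theorem Res12 {e u : ℤ} {n : ℕ} (h : chk12 e u n = true) {x y : ℝ} (hx : 0 ≤ x) (hx1 : x ≤ 1)
    (hy : 0 ≤ y) (hy1 : y ≤ 1) : Res .one .two e u x y := by
  simp only [chk12, Bool.and_eq_true] at h
  obtain ⟨⟨⟨h1, h2⟩, h3⟩, h4⟩ := h
  rcases le_total x (1 / 2) with hc | hc
  · rcases le_total y (2 * x) with hd | hd
    · obtain ⟨t, ht, ht1, hq⟩ := par hx (v := y / 2) (by linarith) zero_le_one (by linarith)
      refine Res_of_eq (chk_sound h1 (s := x) (t := t) hx hc ht ht1) ?_ ?_ <;> simp [ev, rev]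
      linarith
    · obtain ⟨t, ht, ht1, hq⟩ := par hy hx (c := 1 / 2) (by norm_num) (by linarith)
      refine Res_of_eq (chk_sound h2 (s := y) (t := t) hy hy1 ht ht1) ?_ ?_ <;> simp [ev, rev]
      linarith
  · rcases le_total y (2 * (1 - x)) with hd | hd
    · obtain ⟨t, ht, ht1, hq⟩ := par (u := 1 - x) (by linarith) (v := y / 2) (by linarith)
        zero_le_one (by linarith)
      refine Res_of_eq (chk_sound h3 (s := 1 - x) (t := t) (by linarith)
        (by simp only [hb]; linarith) ht ht1) ?_ ?_ <;> simp [ev, rev]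
      linarith
    · obtain ⟨t, ht, ht1, hq⟩ := par hy (v := 1 - x) (by linarith) (c := 1 / 2) (by norm_num)
        (by linarith)
      refine Res_of_eq (chk_sound h4 (s := y) (t := t) hy hy1 ht ht1) ?_ ?_ <;> simp [ev, rev]
      linarith

theorem Res22 {e u : ℤ} {n : ℕ} (h : chk22 e u n = true) {x y : ℝ} (hx : 0 ≤ x) (hx1 : x ≤ 1)
    (hy : 0 ≤ y) (hy1 : y ≤ 1) : Res .two .two e u x y := by
  have main : ∀ x y : ℝ, 0 ≤ x → x ≤ 1 → 0 ≤ y → y ≤ 1 → y ≤ x → Res .two .two e u x y := by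
    intro x y hx hx1 hy hy1 hxy
    obtain ⟨t, ht, ht1, hq⟩ := par hx hy zero_le_one (by linarith)
    refine Res_of_eq (chk_sound h (s := x) (t := t) hx hx1 ht ht1) ?_ ?_ <;> simp [ev, rev]
    linarith
  rcases le_total y x with hxy | hxy
  · exact main x y hx hx1 hy hy1 hxy
  · exact Res_symm _ _ _ _ _ _ (main y x hy hy1 hx hx1 hxy)

theorem Resb {c : Pc} {e u : ℤ} (h : chkb c e u = true) {x y : ℝ} (hx : 0 ≤ x) (hx1 : x ≤ 1)
    (hy : 0 ≤ y) (hy1 : y ≤ 1) : Res c .back e u x y := by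
  refine Res_of_eq (chk_sound h (s := x) (t := y) hx hx1 hy hy1) ?_ ?_ <;> simp [ev, rev]

/-- Both results needed for a pair of points. -/
def Both (c d : Pc) (e : ℤ) (x y : ℝ) : Prop :=
  (0 ≤ ker c d e x y ∨ Res c d e 0 x y) ∧ Res c d e 1 x y

theorem ker_nonneg_front {c d : Pc} (hc : c ≠ .back) (hd : d ≠ .back) {x y : ℝ} (hx : 0 ≤ x)
    (hx1 : x ≤ 1) (hy : 0 ≤ y) (hy1 : y ≤ 1) : 0 ≤ ker c d (1 : ℤ) x y := by
  have key : ∀ c : Pc, c ≠ .back → ∀ x : ℝ, 0 ≤ x → x ≤ 1 → 0 ≤ rev (La c) x ∧ 0 ≤ rev (Lb c) x := by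
    intro c hc x hx hx1
    cases c
    · constructor <;> simp [La, Lb, rev] <;> linarith
    · constructor <;> simp [La, Lb, rev] <;> linarith
    · exact absurd rfl hc
  obtain ⟨h1, h2⟩ := key c hc x hx hx1
  obtain ⟨h3, h4⟩ := key d hd y hy hy1
  unfold ker
  push_cast
  positivity

theorem Both_symm {c d : Pc} {e : ℤ} {x y : ℝ} (h : Both c d e x y) : Both d c e y x := by
  refine ⟨h.1.imp (fun h => ?_) (Res_symm _ _ _ _ _ _), Res_symm _ _ _ _ _ _ h.2⟩
  have h1 : ker d c e y x = ker c d e x y := by unfold ker; ring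
  rw [h1]; exact h

theorem both_back (c : Pc) (e : ℤ) (he : e = 1 ∨ e = -1) {x y : ℝ} (hx : 0 ≤ x)
    (hx1 : x ≤ 1) (hy : 0 ≤ y) (hy1 : y ≤ 1) : Both c .back e x y := by
  have h : (chkb c 1 1 && chkb c 1 0 && chkb c (-1) 1 && chkb c (-1) 0) = true := by
    cases c
    · exact chkb_one
    · exact chkb_two
    · exact chkb_back
  simp only [Bool.and_eq_true] at h
  obtain ⟨⟨⟨h1, h2⟩, h3⟩, h4⟩ := h
  rcases he with rfl | rfl
  · exact ⟨Or.inr (Resb h2 hx hx1 hy hy1), Resb h1 hx hx1 hy hy1⟩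
  · exact ⟨Or.inr (Resb h4 hx hx1 hy hy1), Resb h3 hx hx1 hy hy1⟩

theorem both (c d : Pc) (e : ℤ) (he : e = 1 ∨ e = -1) {x y : ℝ} (hx : 0 ≤ x)
    (hx1 : x ≤ 1) (hy : 0 ≤ y) (hy1 : y ≤ 1) : Both c d e x y := by
  cases d
  · cases c
    · rcases he with rfl | rfl
      · exact ⟨Or.inl (ker_nonneg_front (by simp) (by simp) hx hx1 hy hy1),
          Res11 chk11_a hx hx1 hy hy1⟩
      · exact ⟨Or.inr (Res11 chk11_c hx hx1 hy hy1), Res11 chk11_b hx hx1 hy hy1⟩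
    · apply Both_symm
      rcases he with rfl | rfl
      · exact ⟨Or.inl (ker_nonneg_front (by simp) (by simp) hy hy1 hx hx1),
          Res12 chk12_a hy hy1 hx hx1⟩
      · exact ⟨Or.inr (Res12 chk12_c hy hy1 hx hx1), Res12 chk12_b hy hy1 hx hx1⟩
    · exact Both_symm (both_back _ e he hy hy1 hx hx1)
  · cases c
    · rcases he with rfl | rfl
      · exact ⟨Or.inl (ker_nonneg_front (by simp) (by simp) hx hx1 hy hy1),
          Res12 chk12_a hx hx1 hy hy1⟩
      · exact ⟨Or.inr (Res12 chk12_c hx hx1 hy hy1), Res12 chk12_b hx hx1 hy hy1⟩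
    · rcases he with rfl | rfl
      · exact ⟨Or.inl (ker_nonneg_front (by simp) (by simp) hx hx1 hy hy1),
          Res22 chk22_a hx hx1 hy hy1⟩
      · exact ⟨Or.inr (Res22 chk22_c hx hx1 hy hy1), Res22 chk22_b hx hx1 hy hy1⟩
    · exact Both_symm (both_back _ e he hy hy1 hx hx1)
  · exact both_back _ e he hx hx1 hy hy1

theorem al_nonneg (c d : Pc) (e : ℤ) (he : e = 1 ∨ e = -1) {x y : ℝ} (hx : 0 ≤ x)
    (hx1 : x ≤ 1) (hy : 0 ≤ y) (hy1 : y ≤ 1) : 0 ≤ al c d e x y := by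
  have key : chka c d e = true := by
    have h : ([Pc.one, .two, .back].all fun d => chka c d 1 && chka c d (-1)) = true := by
      cases c
      · exact chka_one
      · exact chka_two
      · exact chka_back
    rw [List.all_eq_true] at h
    have h' := h d (by cases d <;> simp)
    rw [Bool.and_eq_true] at h'
    rcases he with rfl | rfl
    · exact h'.1
    · exact h'.2
  have h := check_sound _ _ _ _ key hx hx1 hy hy1
  rcases h with h | ⟨q, hq, h⟩
  · rw [ev_alB] at h
    simpa [ev, rev] using h
  · simp at hq

/-- The pair inequality at normalized points. -/
theorem pair_norm (c d : Pc) (e : ℤ) (he : e = 1 ∨ e = -1) {x y : ℝ} (hx : 0 ≤ x)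
    (hx1 : x ≤ 1) (hy : 0 ≤ y) (hy1 : y ≤ 1) {r q : ℝ} (hr : 0 ≤ r) (hq : 0 ≤ q) :
    144 * (max (ker c d e x y) 0 * (r * q)) + off c d e x y * (r * q)
      ≤ 2 * (al c d e x y * r ^ 2) + 2 * (al d c e y x * q ^ 2) := by
  have h1 := al_nonneg c d e he hx hx1 hy hy1
  have h2 := al_nonneg d c e he hy hy1 hx hx1
  have hb := both c d e he hx hx1 hy hy1
  have hrq : 0 ≤ r * q := mul_nonneg hr hq
  have amgm : ∀ R : ℝ, R ^ 2 ≤ 16 * (al c d e x y * al d c e y x) ∨ R ≤ 0 →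
      R * (r * q) ≤ 2 * (al c d e x y * r ^ 2) + 2 * (al d c e y x * q ^ 2) := by
    intro R hR
    rcases hR with hR | hR
    · refine le_trans (le_abs_self _) (abs_le_of_sq_le_sq ?_ (by positivity))
      · nlinarith [mul_le_mul_of_nonneg_right hR (sq_nonneg (r * q)),
          sq_nonneg (al c d e x y * r ^ 2 - al d c e y x * q ^ 2)]
    · have : R * (r * q) ≤ 0 := mul_nonpos_of_nonpos_of_nonneg hR hrq
      have : 0 ≤ 2 * (al c d e x y * r ^ 2) + 2 * (al d c e y x * q ^ 2) := by positivity
      linarith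
  obtain ⟨hb0, hb1⟩ := hb
  unfold Res at hb0 hb1
  push_cast at hb0 hb1
  rcases le_or_gt 0 (ker c d e x y) with hk | hk
  · rw [max_eq_left hk]
    have := amgm (144 * ker c d e x y + off c d e x y) (by
      rcases hb1 with h | h | h
      · left; rw [one_mul] at h; exact h
      · linarith
      · right; linarith)
    linarith
  · rw [max_eq_right hk.le]
    have := amgm (off c d e x y) (by
      rcases hb0 with h | h | h | h
      · linarith
      · left; simpa using h
      · linarith
      · right; linarith)
    linarith

/-! ### From pairs of points to vectors -/

/-- Weights and multipliers attached to a point of the plane. -/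
structure Vtx (a b : ℝ) where
  c : Pc
  x : ℝ
  r : ℝ
  s : ℤ
  hx : 0 ≤ x
  hx1 : x ≤ 1
  hr : 0 ≤ r
  hs : s = 1 ∨ s = -1
  ha : a = r * rev (La c) x
  hb : b = s * (r * rev (Lb c) x)

theorem exists_vtx_pos (a b : ℝ) (hb : 0 ≤ b) : ∃ v : Vtx a b, v.s = 1 := by
  rcases le_or_gt 0 a with ha | ha
  · rcases le_total b a with hc | hc
    · obtain ⟨x, hx, hx1, e⟩ := par (u := (a + b) / 2) (v := b) (by linarith) hb zero_le_one
        (by linarith)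
      refine ⟨⟨.one, x, (a + b) / 2, 1, hx, hx1, by linarith, Or.inl rfl, ?_, ?_⟩, rfl⟩ <;>
        simp [La, Lb, rev] <;> linarith
    · obtain ⟨x, hx, hx1, e⟩ := par (u := (a + b) / 2) (v := (b - a) / 2) (by linarith)
        (by linarith) zero_le_one (by linarith)
      refine ⟨⟨.two, x, (a + b) / 2, 1, hx, hx1, by linarith, Or.inl rfl, ?_, ?_⟩, rfl⟩ <;>
        simp [La, Lb, rev] <;> linarith
  · obtain ⟨x, hx, hx1, e⟩ := par (u := -a + b) (v := -a) (by linarith)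
      (by linarith) zero_le_one (by linarith)
    refine ⟨⟨.back, x, -a + b, 1, hx, hx1, by linarith, Or.inl rfl, ?_, ?_⟩, rfl⟩ <;>
        simp [La, Lb, rev] <;> linarith

theorem exists_vtx (a b : ℝ) : Nonempty (Vtx a b) := by
  rcases le_total 0 b with hb | hb
  · exact ⟨(exists_vtx_pos a b hb).choose⟩
  · obtain ⟨v, hv⟩ := exists_vtx_pos a (-b) (by linarith)
    refine ⟨⟨v.c, v.x, v.r, -1, v.hx, v.hx1, v.hr, Or.inr rfl, v.ha, ?_⟩⟩
    have := v.hb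
    rw [hv] at this
    push_cast at this ⊢
    linarith

namespace Vtx
variable {a b : ℝ} (v : Vtx a b)
/-- weight -/
noncomputable def P : ℝ := rev (Lp v.c) v.x
/-- weight -/
noncomputable def T : ℝ := v.s * rev (Lt v.c) v.x
/-- multiplier -/
noncomputable def g : ℝ := v.s * (v.r * rev (Lg v.c) v.x)
/-- multiplier -/
noncomputable def H : ℝ := v.r * rev (Lh v.c) v.x
/-- multiplier -/
noncomputable def M : ℝ := v.r * rev (Lm v.c) v.x

theorem M_nonneg : 0 ≤ v.M := by
  refine mul_nonneg v.hr ?_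
  have := v.hx
  cases v.c <;> simp [Lm, rev]
  exact this
end Vtx

theorem pair_ineq {a b a' b' : ℝ} (v : Vtx a b) (w : Vtx a' b') :
    144 * max (3 * (a * a') + 7 * (b * b')) 0 ≤
      2 * (3 * w.P * a ^ 2 + (288 - 7 * w.P) * b ^ 2 + 3 * w.T * (a * b))
      + 2 * (3 * v.P * a' ^ 2 + (288 - 7 * v.P) * b' ^ 2 + 3 * v.T * (a' * b'))
      - v.H * w.H + 6 * (b * w.g + b' * v.g) - 6 * (a * w.M + a' * v.M) := by
  obtain ⟨c, x, r, s, hx, hx1, hr, hs, rfl, rfl⟩ := v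
  obtain ⟨d, y, q, t, hy, hy1, hq, ht, rfl, rfl⟩ := w
  simp only [Vtx.P, Vtx.T, Vtx.g, Vtx.H, Vtx.M]
  have he : s * t = 1 ∨ s * t = -1 := by
    rcases hs with rfl | rfl <;> rcases ht with rfl | rfl <;> simp
  have h := pair_norm c d (s * t) he hx hx1 hy hy1 hr hq
  have hrq : 0 ≤ r * q := mul_nonneg hr hq
  rw [max_mul_of_nonneg _ _ hrq, zero_mul] at h
  have s2 : (s : ℝ) ^ 2 = 1 := by rcases hs with rfl | rfl <;> norm_num
  have t2 : (t : ℝ) ^ 2 = 1 := by rcases ht with rfl | rfl <;> norm_num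
  unfold ker off al at h
  push_cast at h
  generalize rev (La c) x = A at *
  generalize rev (Lb c) x = B at *
  generalize rev (La d) y = A' at *
  generalize rev (Lb d) y = B' at *
  generalize rev (Lp c) x = p at *
  generalize rev (Lp d) y = p' at *
  generalize rev (Lt c) x = z at *
  generalize rev (Lt d) y = z' at *
  generalize rev (Lg c) x = g at *
  generalize rev (Lg d) y = g' at *
  generalize rev (Lh c) x = k at *
  generalize rev (Lh d) y = k' at *
  generalize rev (Lm c) x = m at *
  generalize rev (Lm d) y = m' at *
  have e1 : 3 * (r * A * (q * A')) + 7 * (s * (r * B) * (t * (q * B')))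
      = (3 * (A * A') + 7 * (s * t) * (B * B')) * (r * q) := by ring
  rw [e1]
  refine sub_nonneg.1 ?_
  have h' := sub_nonneg.2 h
  convert h' using 1
  linear_combination (2 * (288 - 7 * p') * (r * B) ^ 2) * s2 + (2 * (288 - 7 * p) * (q * B') ^ 2) * t2

open Finset in
/-- The main inequality for balanced vectors. -/
theorem main_sum {ι : Type*} [Fintype ι] (a b : ι → ℝ) (h1 : ∑ i, a i ^ 2 = 1 / 3)
    (h2 : ∑ i, b i ^ 2 = 1 / 7) (h3 : ∑ i, a i * b i = 0) (h4 : ∑ i, b i = 0)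
    (h5 : 0 ≤ ∑ i, a i) :
    ∑ i, ∑ j, max (3 * (a i * a j) + 7 * (b i * b j)) 0 ≤ 8 / 7 * (Fintype.card ι : ℝ) := by
  have v : ∀ i, Vtx (a i) (b i) := fun i => (exists_vtx (a i) (b i)).some
  have hM : 0 ≤ ∑ i, (v i).M := sum_nonneg fun i _ => (v i).M_nonneg
  have hsum := sum_le_sum fun i (_ : i ∈ univ) => sum_le_sum fun j (_ : j ∈ univ) =>
    pair_ineq (v i) (v j)
  have key : ∑ i, ∑ j, (2 * (3 * (v j).P * a i ^ 2 + (288 - 7 * (v j).P) * b i ^ 2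
        + 3 * (v j).T * (a i * b i))
      + 2 * (3 * (v i).P * a j ^ 2 + (288 - 7 * (v i).P) * b j ^ 2 + 3 * (v i).T * (a j * b j))
      - (v i).H * (v j).H + 6 * (b i * (v j).g + b j * (v i).g)
      - 6 * (a i * (v j).M + a j * (v i).M))
      = 1152 / 7 * (Fintype.card ι : ℝ) - (∑ i, (v i).H) ^ 2
        - 12 * ((∑ i, a i) * ∑ i, (v i).M) := by
    have e : ∀ i j, (2 * (3 * (v j).P * a i ^ 2 + (288 - 7 * (v j).P) * b i ^ 2
        + 3 * (v j).T * (a i * b i))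
      + 2 * (3 * (v i).P * a j ^ 2 + (288 - 7 * (v i).P) * b j ^ 2 + 3 * (v i).T * (a j * b j))
      - (v i).H * (v j).H + 6 * (b i * (v j).g + b j * (v i).g)
      - 6 * (a i * (v j).M + a j * (v i).M))
      = 6 * ((v j).P * a i ^ 2) + 576 * (1 * b i ^ 2) - 14 * ((v j).P * b i ^ 2)
        + 6 * ((v j).T * (a i * b i))
        + 6 * ((v i).P * a j ^ 2) + 576 * (1 * b j ^ 2) - 14 * ((v i).P * b j ^ 2)
        + 6 * ((v i).T * (a j * b j))
        - (v i).H * (v j).H + 6 * (b i * (v j).g) + 6 * (b j * (v i).g)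
      - 6 * (a i * (v j).M) - 6 * (a j * (v i).M) := by intros; ring
    simp only [e, sum_add_distrib, sum_sub_distrib, ← mul_sum, ← sum_mul, h1, h2, h3, h4]
    simp only [sum_const, card_univ, nsmul_eq_mul, ← mul_sum, one_mul, h2]
    ring
  rw [key] at hsum
  simp only [← mul_sum] at hsum
  nlinarith [sq_nonneg (∑ i, (v i).H), mul_nonneg h5 hM]

open Finset in
/-- The inequality for orthonormal balanced pairs. -/
theorem balanced_sum {ι : Type*} [Fintype ι] (x y : ι → ℝ) (h1 : ∑ i, x i ^ 2 = 1)
    (h2 : ∑ i, y i ^ 2 = 1) (h3 : ∑ i, x i * y i = 0) (h4 : ∑ i, y i = 0)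
    (h5 : 0 ≤ ∑ i, x i) :
    ∑ i, ∑ j, max (x i * x j + y i * y j) 0 ≤ 8 / 7 * (Fintype.card ι : ℝ) := by
  have s3 : (√3 : ℝ)⁻¹ ^ 2 = 1 / 3 := by rw [inv_pow, Real.sq_sqrt (by norm_num)]; norm_num
  have s7 : (√7 : ℝ)⁻¹ ^ 2 = 1 / 7 := by rw [inv_pow, Real.sq_sqrt (by norm_num)]; norm_num
  have h := main_sum (fun i => (√3)⁻¹ * x i) (fun i => (√7)⁻¹ * y i)
    (by simp only [mul_pow, ← mul_sum, h1, s3]; norm_num)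
    (by simp only [mul_pow, ← mul_sum, h2, s7]; norm_num)
    (by
      have : ∀ i, (√3)⁻¹ * x i * ((√7)⁻¹ * y i) = ((√3)⁻¹ * (√7)⁻¹) * (x i * y i) := by
        intro i; ring
      simp only [this, ← mul_sum, h3, mul_zero])
    (by simp only [← mul_sum, h4, mul_zero])
    (by simp only [← mul_sum]; positivity)
  have e : ∀ i j, 3 * ((√3)⁻¹ * x i * ((√3)⁻¹ * x j)) + 7 * ((√7)⁻¹ * y i * ((√7)⁻¹ * y j))
      = x i * x j + y i * y j := by
    intro i j
    linear_combination (3 * x i * x j) * s3 + (7 * y i * y j) * s7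
  simp only [e] at h
  exact h

open Finset in
/-- The inequality for orthonormal pairs. -/
theorem orth_sum {ι : Type*} [Fintype ι] (u w : ι → ℝ) (h1 : ∑ i, u i ^ 2 = 1)
    (h2 : ∑ i, w i ^ 2 = 1) (h3 : ∑ i, u i * w i = 0) :
    ∑ i, ∑ j, max (u i * u j + w i * w j) 0 ≤ 8 / 7 * (Fintype.card ι : ℝ) := by
  obtain ⟨c, s, hcs, h4, h5⟩ : ∃ c s : ℝ, c ^ 2 + s ^ 2 = 1 ∧
      -s * (∑ i, u i) + c * (∑ i, w i) = 0 ∧ 0 ≤ c * (∑ i, u i) + s * (∑ i, w i) := by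
    generalize (∑ i, u i) = U
    generalize (∑ i, w i) = W
    rcases eq_or_ne (U ^ 2 + W ^ 2) 0 with h | h
    · have hU : U = 0 := by nlinarith [sq_nonneg U, sq_nonneg W]
      have hW : W = 0 := by nlinarith [sq_nonneg U, sq_nonneg W]
      exact ⟨1, 0, by norm_num, by simp [hU, hW], by simp [hU, hW]⟩
    · have hp : 0 < U ^ 2 + W ^ 2 := lt_of_le_of_ne (by positivity) (Ne.symm h)
      have hr := Real.sqrt_pos.2 hp
      have hr2 := Real.sq_sqrt hp.le
      set r := √(U ^ 2 + W ^ 2)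
      refine ⟨U / r, W / r, ?_, by ring, ?_⟩
      · rw [div_pow, div_pow, ← add_div, hr2, div_self h]
      · have : U / r * U + W / r * W = (U ^ 2 + W ^ 2) / r := by ring
        rw [this]; positivity
  have h := balanced_sum (fun i => c * u i + s * w i) (fun i => -s * u i + c * w i)
    (by
      have : ∀ i, (c * u i + s * w i) ^ 2 = c ^ 2 * u i ^ 2 + 2 * c * s * (u i * w i)
          + s ^ 2 * w i ^ 2 := by intro i; ring
      simp only [this, sum_add_distrib, ← mul_sum, h1, h2, h3]; linarith)
    (by
      have : ∀ i, (-s * u i + c * w i) ^ 2 = s ^ 2 * u i ^ 2 - 2 * c * s * (u i * w i)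
          + c ^ 2 * w i ^ 2 := by intro i; ring
      simp only [this, sum_add_distrib, sum_sub_distrib, ← mul_sum, h1, h2, h3]; linarith)
    (by
      have : ∀ i, (c * u i + s * w i) * (-s * u i + c * w i) = (-s * c) * u i ^ 2
          + (c ^ 2 - s ^ 2) * (u i * w i) + (s * c) * w i ^ 2 := by intro i; ring
      simp only [this, sum_add_distrib, ← mul_sum, h1, h2, h3]; ring)
    (by simp only [sum_add_distrib, ← mul_sum]; exact h4)
    (by simp only [sum_add_distrib, ← mul_sum]; exact h5)
  have e : ∀ i j, (c * u i + s * w i) * (c * u j + s * w j)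
      + (-s * u i + c * w i) * (-s * u j + c * w j) = u i * u j + w i * w j := by
    intro i j
    linear_combination (u i * u j + w i * w j) * hcs
  simp only [e] at h
  exact h

end Cert

/-- for every graph `G` on `n` vertices, `λ₁(G) + λ₂(G) ≤ (8/7)·n`. -/
theorem stmt8 {n : ℕ} (G : SimpleGraph (Fin n)) [DecidableRel G.Adj] :
    specSum G ≤ (8 / 7 : ℝ) * n := by
  refine Real.sSup_le ?_ (by positivity)
  rintro z ⟨i, j, hij, rfl⟩
  set hA := adjMatrix_isHermitian G with hhA
  have ho := hA.eigenvectorBasis.orthonormal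
  have inn : ∀ p q : EuclideanSpace ℝ (Fin n), inner ℝ p q = ∑ k, p k * q k := by
    intro p q
    rw [PiLp.inner_apply]
    refine Finset.sum_congr rfl fun k _ => ?_
    simp [mul_comm]
  have hn : ∀ i, ∑ k, hA.eigenvectorBasis i k ^ 2 = 1 := by
    intro i
    have h := orthonormal_iff_ite.1 ho i i
    rw [inn] at h
    simpa [sq] using h
  have hort : ∑ k, hA.eigenvectorBasis i k * hA.eigenvectorBasis j k = 0 := by
    have h : inner ℝ (hA.eigenvectorBasis i) (hA.eigenvectorBasis j) = 0 := ho.2 hij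
    rwa [inn] at h
  have hev : ∀ i, hA.eigenvalues i = ∑ k, ∑ l, G.adjMatrix ℝ k l *
      (hA.eigenvectorBasis i k * hA.eigenvectorBasis i l) := by
    intro i
    have h := hA.mulVec_eigenvectorBasis i
    have h2 : ∀ k, ∑ l, G.adjMatrix ℝ k l * hA.eigenvectorBasis i l
        = hA.eigenvalues i * hA.eigenvectorBasis i k := fun k => congrFun h k
    calc hA.eigenvalues i = ∑ k, hA.eigenvectorBasis i k *
          (hA.eigenvalues i * hA.eigenvectorBasis i k) := by
          have e : ∀ k, hA.eigenvectorBasis i k * (hA.eigenvalues i * hA.eigenvectorBasis i k)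
            = hA.eigenvalues i * hA.eigenvectorBasis i k ^ 2 := fun k => by ring
          simp only [e, ← Finset.mul_sum, hn, mul_one]
      _ = _ := by
          refine Finset.sum_congr rfl fun k _ => ?_
          rw [← h2, Finset.mul_sum]
          refine Finset.sum_congr rfl fun l _ => ?_
          ring
  have hmain := Cert.orth_sum _ _ (hn i) (hn j) hort
  rw [Fintype.card_fin] at hmain
  refine le_trans ?_ hmain
  rw [hev i, hev j, ← Finset.sum_add_distrib]
  refine Finset.sum_le_sum fun k _ => ?_
  rw [← Finset.sum_add_distrib]
  refine Finset.sum_le_sum fun l _ => ?_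
  rw [← mul_add, SimpleGraph.adjMatrix_apply]
  split_ifs
  · rw [one_mul]; exact le_max_left _ _
  · rw [zero_mul]; exact le_max_right _ _
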